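/- Let 1 < p ≤ 2, M > 0 and a = (a', 0) ∈ ∂ℝⁿ₊. Define D_a = {x ∈ ℝⁿ₊ : |x - a| < 2} and Σ_a = {x ∈ ℝⁿ : |x - a| < 2, xₙ = 0}. Let u ∈ C²(D_a) ∩ C(cl D_a) satisfy -Δu ≤ |∇u|^p in D_a, u = 0 on Σ_a, and u ≤ M in cl D_a. Then there exists M₁ > 0 depending only on M, n, p such that u(a', xₙ) ≤ M₁ xₙ for all 0 < xₙ ≤ 1. -/

import Mathlib

/-- The classical Laplacian of `u : ℝⁿ → ℝ`: the sum of the pure second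
derivatives `∂²u/∂xᵢ²`. -/
noncomputable def laplacian {n : ℕ} (u : EuclideanSpace ℝ (Fin n) → ℝ)
    (x : EuclideanSpace ℝ (Fin n)) : ℝ :=
  ∑ i, iteratedFDeriv ℝ 2 u x ![EuclideanSpace.single i 1, EuclideanSpace.single i 1]

/-- `D_a = {x ∈ ℝⁿ₊ : |x - a| < 2}`, the half-ball of radius `2` around a boundary
point `a` (dimension `n + 1`). -/
def Dset (n : ℕ) (a : EuclideanSpace ℝ (Fin (n + 1))) : Set (EuclideanSpace ℝ (Fin (n + 1))) :=
  {x | 0 < x (Fin.last n) ∧ dist x a < 2}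

/-- `Σ_a = {x ∈ ℝⁿ : |x - a| < 2, xₙ = 0}`, the flat part of the boundary. -/
def Sigmaset (n : ℕ) (a : EuclideanSpace ℝ (Fin (n + 1))) : Set (EuclideanSpace ℝ (Fin (n + 1))) :=
  {x | dist x a < 2 ∧ x (Fin.last n) = 0}

/-- One-dimensional second derivative comparison at a local maximum. -/
theorem one_dim_cmp (f f' : ℝ → ℝ) (f2 w0 w1 w2 : ℝ) (hw : 0 < w0)
    (hf : ∀ᶠ s in nhds (0:ℝ), HasDerivAt f (f' s) s) (hf' : HasDerivAt f' f2 0)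
    (hmax : IsLocalMax (fun s => f s - Real.log (w0 + w1 * s + w2 * s ^ 2)) 0) :
    f' 0 = w1 / w0 ∧ f2 ≤ 2 * w2 / w0 - (w1 / w0) ^ 2 := by
  set q : ℝ → ℝ := fun s => w0 + w1 * s + w2 * s ^ 2 with hq
  have hq' : ∀ s, HasDerivAt q (w1 + 2 * w2 * s) s := by
    intro s
    have h1 := ((hasDerivAt_id s).const_mul w1).const_add w0
    have h2 := ((hasDerivAt_id s).pow 2).const_mul w2
    have h3 := h1.add h2
    refine h3.congr_deriv ?_
    simp; ring
  have hq0 : q 0 = w0 := by simp [hq]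
  have hqpos : ∀ᶠ s in nhds (0:ℝ), 0 < q s :=
    (hq' 0).continuousAt.eventually (lt_mem_nhds (by rw [hq0]; exact hw))
  set g : ℝ → ℝ := fun s => f s - Real.log (q s) with hg
  have hgd : ∀ᶠ s in nhds (0:ℝ), HasDerivAt g (f' s - (w1 + 2 * w2 * s) / q s) s := by
    filter_upwards [hf, hqpos] with s h1 h2
    exact h1.sub ((hq' s).log h2.ne')
  have hderiv : deriv g =ᶠ[nhds 0] fun s => f' s - (w1 + 2 * w2 * s) / q s := by
    filter_upwards [hgd] with s hs using hs.deriv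
  have hg2 : HasDerivAt (fun s => f' s - (w1 + 2 * w2 * s) / q s)
      (f2 - (2 * w2 / w0 - (w1 / w0) ^ 2)) 0 := by
    have hl : HasDerivAt (fun s : ℝ => w1 + 2 * w2 * s) (2 * w2) 0 := by
      simpa using ((hasDerivAt_id (0:ℝ)).const_mul (2 * w2)).const_add w1
    have h := hf'.sub (hl.div (hq' 0) (by rw [hq0]; exact hw.ne'))
    refine h.congr_deriv ?_
    rw [hq0]; field_simp; ring
  have hdd : deriv (deriv g) 0 = f2 - (2 * w2 / w0 - (w1 / w0) ^ 2) := by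
    rw [hderiv.deriv_eq]; exact hg2.deriv
  have hd0 : deriv g 0 = 0 := IsLocalMax.deriv_eq_zero hmax
  constructor
  · have := hderiv.self_of_nhds
    simp [hd0, hq0] at this
    linarith
  · by_contra hcon
    push Not at hcon
    have hmin : IsLocalMin g 0 := isLocalMin_of_deriv_deriv_pos (by rw [hdd]; linarith) hd0
      hgd.self_of_nhds.continuousAt
    have hconst : g =ᶠ[nhds 0] fun _ => g 0 := by
      filter_upwards [hmin, hmax] with s h1 h2
      exact le_antisymm h2 h1
    have h1 : deriv g =ᶠ[nhds 0] deriv (fun _ => g 0) := hconst.deriv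
    have h2 := h1.deriv_eq
    rw [hdd] at h2
    simp at h2
    linarith

theorem rpow_le_one_add_sq (r p : ℝ) (hr : 0 ≤ r) (hp1 : 1 < p) (hp2 : p ≤ 2) :
    r ^ p ≤ 1 + r ^ 2 := by
  rcases le_total r 1 with h | h
  · have := Real.rpow_le_one hr h (by linarith : (0:ℝ) ≤ p)
    nlinarith
  · have := Real.rpow_le_rpow_of_exponent_le h hp2
    rw [Real.rpow_two] at this
    linarith

/-- The barrier (before taking the logarithm). -/
noncomputable def barW (n : ℕ) (C E : ℝ) (y : EuclideanSpace ℝ (Fin (n + 1))) : ℝ :=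
  1 + C * y (Fin.last n) + E * ‖y‖ ^ 2 - C * (y (Fin.last n)) ^ 2

theorem barW_line (n : ℕ) (C E : ℝ) (y : EuclideanSpace ℝ (Fin (n + 1))) (i : Fin (n + 1)) (s : ℝ) :
    barW n C E (y + s • EuclideanSpace.single i 1) =
      barW n C E y + ((if i = Fin.last n then C - 2 * C * y (Fin.last n) else 0) + 2 * E * y i) * s
        + (E - if i = Fin.last n then C else 0) * s ^ 2 := by
  have h1 : ‖y + s • EuclideanSpace.single i (1:ℝ)‖ ^ 2 = ‖y‖ ^ 2 + 2 * (s * y i) + s ^ 2 := by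
    rw [norm_add_sq_real, inner_smul_right, norm_smul]
    simp [EuclideanSpace.inner_single_right]
  unfold barW
  rw [h1]
  by_cases h : i = Fin.last n
  · subst h; simp; ring
  · have : Fin.last n ≠ i := fun h' => h h'.symm
    simp [h, this]; ring

theorem barW_sum (n : ℕ) (C E : ℝ) :
    ∑ i : Fin (n + 1), (E - if i = Fin.last n then C else 0) = (n + 1) * E - C := by
  simp [Finset.sum_sub_distrib]

theorem line_derivs {n : ℕ} (u : EuclideanSpace ℝ (Fin n) → ℝ) (x e : EuclideanSpace ℝ (Fin n))
    (hu : ContDiffAt ℝ 2 u x) :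
    (∀ᶠ s in nhds (0:ℝ), HasDerivAt (fun s => u (x + s • e)) (fderiv ℝ u (x + s • e) e) s) ∧
    HasDerivAt (fun s : ℝ => fderiv ℝ u (x + s • e) e) (iteratedFDeriv ℝ 2 u x ![e, e]) 0 := by
  have hl : ∀ s : ℝ, HasDerivAt (fun s : ℝ => x + s • e) e s := by
    intro s
    simpa using ((hasDerivAt_id s).smul_const e).const_add x
  have hx : x + (0:ℝ) • e = x := by simp
  constructor
  · have h1 : ∀ᶠ z in nhds x, ContDiffAt ℝ 2 u z := hu.eventually (by simp)
    have h2 : Filter.Tendsto (fun s : ℝ => x + s • e) (nhds 0) (nhds x) := by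
      have := (hl 0).continuousAt.tendsto
      rwa [hx] at this
    filter_upwards [h2.eventually h1] with s hs
    exact (hs.differentiableAt (by norm_num)).hasFDerivAt.comp_hasDerivAt s (hl s)
  · have h1 : DifferentiableAt ℝ (fderiv ℝ u) x :=
      (hu.fderiv_right (m := 1) (by norm_num)).differentiableAt (by norm_num)
    have h2 : HasFDerivAt (fderiv ℝ u) (fderiv ℝ (fderiv ℝ u) x) (x + (0:ℝ) • e) := by
      rw [hx]; exact h1.hasFDerivAt
    have h3 := h2.comp_hasDerivAt (0:ℝ) (hl 0)
    have h4 := h3.clm_apply (hasDerivAt_const (0:ℝ) e)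
    rw [iteratedFDeriv_two_apply]
    simpa using h4

theorem grad_norm_sq {n : ℕ} (u : EuclideanSpace ℝ (Fin n) → ℝ) (x : EuclideanSpace ℝ (Fin n)) :
    ‖gradient u x‖ ^ 2 = ∑ i, (fderiv ℝ u x (EuclideanSpace.single i 1)) ^ 2 := by
  rw [EuclideanSpace.norm_sq_eq]
  refine Finset.sum_congr rfl fun i _ => ?_
  have : fderiv ℝ u x (EuclideanSpace.single i 1) = (gradient u x) i := by
    have h := InnerProductSpace.toDual_symm_apply (𝕜 := ℝ) (x := EuclideanSpace.single i (1:ℝ))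
      (y := fderiv ℝ u x)
    rw [← h, EuclideanSpace.inner_single_right]
    simp [gradient]
  rw [this]; simp

theorem barW_lower (n : ℕ) (C E : ℝ) (hC : 0 ≤ C) (y : EuclideanSpace ℝ (Fin (n + 1)))
    (h0 : 0 ≤ y (Fin.last n)) (h1 : ‖y‖ ≤ 1) : 1 + E * ‖y‖ ^ 2 ≤ barW n C E y := by
  have h2 : y (Fin.last n) ≤ 1 :=
    (le_abs_self _).trans ((PiLp.norm_apply_le y (Fin.last n)).trans h1)
  unfold barW
  nlinarith [mul_nonneg hC (mul_nonneg h0 (sub_nonneg.2 h2))]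

/-- Boundary barrier estimate: for `1 < p ≤ 2` and `M > 0`, there is `M₁ > 0`
depending only on `M, n, p` such that any subsolution of `-Δu ≤ |∇u|^p` on `D_a`
vanishing on `Σ_a` and bounded above by `M` satisfies `u(a', xₙ) ≤ M₁ xₙ`
for `0 < xₙ ≤ 1`. -/
theorem boundary_barrier (n : ℕ) (p M : ℝ) (hp1 : 1 < p) (hp2 : p ≤ 2) (hM : 0 < M) :
    ∃ M₁ : ℝ, 0 < M₁ ∧
      ∀ a : EuclideanSpace ℝ (Fin (n + 1)), a (Fin.last n) = 0 →
      ∀ u : EuclideanSpace ℝ (Fin (n + 1)) → ℝ,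
        ContDiffOn ℝ 2 u (Dset n a) →
        ContinuousOn u (closure (Dset n a)) →
        (∀ x ∈ Dset n a, -laplacian u x ≤ ‖gradient u x‖ ^ p) →
        (∀ x ∈ Sigmaset n a, u x = 0) →
        (∀ x ∈ closure (Dset n a), u x ≤ M) →
        ∀ t : ℝ, 0 < t → t ≤ 1 →
          u (a + t • EuclideanSpace.single (Fin.last n) 1) ≤ M₁ * t := by
  set E : ℝ := Real.exp M with hE
  have hE1 : 1 < E := by rw [hE]; exact Real.one_lt_exp_iff.2 hM
  set C : ℝ := 2 * ((n:ℝ) + 2) * E with hC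
  have hn : (0:ℝ) ≤ n := Nat.cast_nonneg n
  have hC0 : 0 < C := by positivity
  refine ⟨C + E, by positivity, ?_⟩
  intro a ha u hu2 huc hpde hbd huM t ht0 ht1
  set K : Set (EuclideanSpace ℝ (Fin (n + 1))) := {x | 0 ≤ x (Fin.last n) ∧ dist x a ≤ 1} with hK
  have hcoord : Continuous fun x : EuclideanSpace ℝ (Fin (n + 1)) => x (Fin.last n) := by fun_prop
  have hKc : IsCompact K := by
    have : K = {x | 0 ≤ x (Fin.last n)} ∩ Metric.closedBall a 1 := by
      ext x; simp [hK, Metric.mem_closedBall]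
    rw [this]
    exact (isCompact_closedBall a 1).inter_left (isClosed_le continuous_const hcoord)
  have hDopen : IsOpen (Dset n a) :=
    (isOpen_lt continuous_const hcoord).inter (isOpen_lt (continuous_id.dist (continuous_const (y := a))) continuous_const)
  have hKD : K ⊆ closure (Dset n a) := by
    rintro x ⟨hx0, hx1⟩
    have hten : Filter.Tendsto (fun s : ℝ => x + s • EuclideanSpace.single (Fin.last n) (1:ℝ))
        (nhdsWithin 0 (Set.Ioi 0)) (nhds x) := by
      have hc : Continuous (fun s : ℝ => x + s • EuclideanSpace.single (Fin.last n) (1:ℝ)) := by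
        fun_prop
      have := (hc.tendsto 0).mono_left (nhdsWithin_le_nhds (s := Set.Ioi 0))
      simpa using this
    refine mem_closure_of_tendsto hten ?_
    filter_upwards [Ioo_mem_nhdsGT (show (0:ℝ) < 1 by norm_num)] with s hs
    refine ⟨?_, ?_⟩
    · simp; linarith [hs.1]
    · have h1 : dist (x + s • EuclideanSpace.single (Fin.last n) (1:ℝ)) x = s := by
        rw [dist_eq_norm, add_sub_cancel_left, norm_smul]
        simp [abs_of_pos hs.1]
      have := dist_triangle (x + s • EuclideanSpace.single (Fin.last n) (1:ℝ)) x a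
      linarith [hs.2]
  have hyl : ∀ x : EuclideanSpace ℝ (Fin (n + 1)), (x - a) (Fin.last n) = x (Fin.last n) := by
    intro x; simp [ha]
  have hWlow : ∀ x ∈ K, 1 + E * ‖x - a‖ ^ 2 ≤ barW n C E (x - a) := by
    intro x hx
    exact barW_lower n C E hC0.le _ (by rw [hyl]; exact hx.1) (by rw [← dist_eq_norm]; exact hx.2)
  have hW1 : ∀ x ∈ K, 1 ≤ barW n C E (x - a) := by
    intro x hx
    have := hWlow x hx
    nlinarith [sq_nonneg ‖x - a‖]
  have hWcont : Continuous (fun x => barW n C E (x - a)) := by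
    unfold barW; fun_prop
  have hgc : ContinuousOn (fun x => u x - Real.log (barW n C E (x - a))) K :=
    (huc.mono hKD).sub (hWcont.continuousOn.log fun x hx => by linarith [hW1 x hx])
  have htK : a + t • EuclideanSpace.single (Fin.last n) (1:ℝ) ∈ K := by
    refine ⟨by simp [ha]; exact ht0.le, ?_⟩
    rw [dist_eq_norm, add_sub_cancel_left, norm_smul]
    simp [abs_of_pos ht0]; exact ht1
  obtain ⟨x, hxK, hxmax⟩ := hKc.exists_isMaxOn ⟨_, htK⟩ hgc
  have key : u x - Real.log (barW n C E (x - a)) ≤ 0 := by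
    by_contra hpos
    push Not at hpos
    have hlog0 : 0 ≤ Real.log (barW n C E (x - a)) := Real.log_nonneg (hW1 x hxK)
    have hx0 : 0 < x (Fin.last n) := by
      rcases hxK.1.lt_or_eq with h | h
      · exact h
      · have := hbd x ⟨by linarith [hxK.2], h.symm⟩
        linarith
    have hx1 : dist x a < 1 := by
      rcases hxK.2.lt_or_eq with h | h
      · exact h
      · have h1 := hWlow x hxK
        rw [← dist_eq_norm, h] at h1
        have h2 : M ≤ Real.log (barW n C E (x - a)) := by
          rw [Real.le_log_iff_exp_le (by linarith [hW1 x hxK])]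
          linarith
        linarith [huM x (hKD hxK)]
    have hxD : x ∈ Dset n a := ⟨hx0, by linarith⟩
    have hKn : K ∈ nhds x := by
      have ho : IsOpen {z : EuclideanSpace ℝ (Fin (n + 1)) | 0 < z (Fin.last n) ∧ dist z a < 1} :=
        (isOpen_lt continuous_const hcoord).inter (isOpen_lt (continuous_id.dist (continuous_const (y := a))) continuous_const)
      exact Filter.mem_of_superset (ho.mem_nhds ⟨hx0, hx1⟩) fun z hz => ⟨hz.1.le, hz.2.le⟩
    have hloc : IsLocalMax (fun x => u x - Real.log (barW n C E (x - a))) x := hxmax.isLocalMax hKn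
    have huat : ContDiffAt ℝ 2 u x := hu2.contDiffAt (hDopen.mem_nhds hxD)
    set w0 := barW n C E (x - a) with hw0
    have hw0pos : 0 < w0 := by linarith [hW1 x hxK]
    have hi : ∀ i : Fin (n + 1), iteratedFDeriv ℝ 2 u x
        ![EuclideanSpace.single i 1, EuclideanSpace.single i 1] ≤
        2 * (E - if i = Fin.last n then C else 0) / w0
          - (fderiv ℝ u x (EuclideanSpace.single i 1)) ^ 2 := by
      intro i
      obtain ⟨h1, h2⟩ := line_derivs u x (EuclideanSpace.single i 1) huat
      have hm : IsLocalMax (fun s : ℝ => u (x + s • EuclideanSpace.single i 1) -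
          Real.log (w0 + ((if i = Fin.last n then C - 2 * C * (x - a) (Fin.last n) else 0)
            + 2 * E * (x - a) i) * s + (E - if i = Fin.last n then C else 0) * s ^ 2)) 0 := by
        have hten : Filter.Tendsto (fun s : ℝ => x + s • EuclideanSpace.single i (1:ℝ))
            (nhds 0) (nhds x) := by
          have hc : Continuous (fun s : ℝ => x + s • EuclideanSpace.single i (1:ℝ)) := by
            fun_prop
          simpa using hc.tendsto 0
        have hev := hten.eventually hloc
        refine hev.mono fun s hs => ?_
        have he := barW_line n C E (x - a) i s
        have hs' : x + s • EuclideanSpace.single i (1:ℝ) - a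
            = x - a + s • EuclideanSpace.single i (1:ℝ) := by abel
        simp only [hs', he] at hs
        simpa [hw0] using hs
      obtain ⟨h3, h4⟩ := one_dim_cmp _ _ _ w0 _ _ hw0pos h1 h2 hm
      rw [← h3] at h4
      simpa using h4
    have hlap : laplacian u x ≤ 2 * (((n:ℝ) + 1) * E - C) / w0 - ‖gradient u x‖ ^ 2 := by
      unfold laplacian
      refine (Finset.sum_le_sum fun i _ => hi i).trans (le_of_eq ?_)
      rw [Finset.sum_sub_distrib, grad_norm_sq, ← barW_sum, Finset.mul_sum, Finset.sum_div]
    have h5 := hpde x hxD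
    have h6 := rpow_le_one_add_sq ‖gradient u x‖ p (norm_nonneg _) hp1 hp2
    have h7 : -1 ≤ 2 * (((n:ℝ) + 1) * E - C) / w0 := by linarith
    rw [le_div_iff₀ hw0pos] at h7
    have h8 : w0 ≤ 1 + C / 4 + E := by
      have hn1 : ‖x - a‖ ≤ 1 := by rw [← dist_eq_norm]; exact hxK.2
      have hn2 : ‖x - a‖ ^ 2 ≤ 1 := by nlinarith [norm_nonneg (x - a)]
      rw [hw0, barW]
      nlinarith [mul_nonneg hC0.le (sq_nonneg ((x - a) (Fin.last n) - 1 / 2)),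
        mul_nonneg (by linarith : 0 ≤ E) (sub_nonneg.2 hn2)]
    have h9 : 0 ≤ (n:ℝ) * E := by positivity
    nlinarith
  have hfin := (hxmax htK).trans key
  have hfin' : u (a + t • EuclideanSpace.single (Fin.last n) 1) ≤
      Real.log (barW n C E (t • EuclideanSpace.single (Fin.last n) 1)) := by
    simp only [add_sub_cancel_left] at hfin
    linarith
  have hWt : barW n C E (t • EuclideanSpace.single (Fin.last n) 1) = 1 + C * t + E * t ^ 2 - C * t ^ 2 := by
    unfold barW
    rw [norm_smul]; simp
  have hWpos := hW1 _ htK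
  rw [add_sub_cancel_left] at hWpos
  have := Real.log_le_sub_one_of_pos (lt_of_lt_of_le one_pos hWpos)
  rw [hWt] at this hfin'
  have ht2 : t ^ 2 ≤ t := by nlinarith
  nlinarith [mul_nonneg hC0.le (sq_nonneg t)]
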